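/- arXiv:1204.4938 — 5 statements merged into one kernel-verified Lean document; each statement's English description precedes it below -/
import Mathlib

section
/- For every integer n ≥ 11, P(f⁻_{[0,n−1]}(R_n'') = n−4) − P(f⁻_{[0,n−1]}(R_n'') = n−5) ≥ (n−10)/2^{n−1} > 0. -/
open Finset Filter

open Classical in
/-- The number of missing sums of `R` in the integer interval `[a, b]`, i.e.
`#{k ∈ ℤ ∩ [a,b] : k ∉ R + R}` where `R + R = {x + y : x, y ∈ R}`. -/
noncomputable def missSum (R : Finset ℕ) (a b : ℤ) : ℕ :=
  ((Finset.Icc a b).filter (fun k => ¬ ∃ x ∈ R, ∃ y ∈ R, (x : ℤ) + (y : ℤ) = k)).card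

open Classical in
/-- The number of missing differences of `R` in the integer interval `[a, b]`, i.e.
`#{k ∈ ℤ ∩ [a,b] : k ∉ R - R}` where `R - R = {x - y : x, y ∈ R}`. -/
noncomputable def missDiff (R : Finset ℕ) (a b : ℤ) : ℕ :=
  ((Finset.Icc a b).filter (fun k => ¬ ∃ x ∈ R, ∃ y ∈ R, (x : ℤ) - (y : ℤ) = k)).card

open Classical in
/-- The probability that the random set `R_n` — a subset of `{0,…,n-1}` in which each
element is included independently with probability `1/2`, i.e. a uniformly random
subset of `{0,…,n-1}` — satisfies the event `p`. -/
noncomputable def pR (n : ℕ) (p : Finset ℕ → Prop) : ℝ :=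
  (((Finset.range n).powerset.filter p).card : ℝ) / 2 ^ n

open Classical in
/-- The probability that the random set `R_n'` — a uniformly random subset of
`{0,…,n-1}` conditioned on containing `0` — satisfies the event `p`. -/
noncomputable def pR' (n : ℕ) (p : Finset ℕ → Prop) : ℝ :=
  (((Finset.range n).powerset.filter (fun S => 0 ∈ S ∧ p S)).card : ℝ) / 2 ^ (n - 1)

open Classical in
/-- The probability that the random set `R_n''` — a uniformly random subset of
`{0,…,n-1}` conditioned on containing both `0` and `n-1` — satisfies the event `p`. -/
noncomputable def pR'' (n : ℕ) (p : Finset ℕ → Prop) : ℝ :=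
  (((Finset.range n).powerset.filter (fun S => 0 ∈ S ∧ n - 1 ∈ S ∧ p S)).card : ℝ) / 2 ^ (n - 2)

open Classical in
/-- The probability that the random set `R_∞` — a subset of `ℕ` in which each
nonnegative integer is included independently with probability `1/2` — satisfies the
event `p`, for an event `p` depending only on the elements `< N` of the set.  Since
each of the `2^N` possibilities for `R_∞ ∩ {0,…,N-1}` is equally likely and `p` is
determined by this intersection, the probability is obtained by counting. -/
noncomputable def probInf (N : ℕ) (p : Finset ℕ → Prop) : ℝ :=
  (((Finset.range N).powerset.filter p).card : ℝ) / 2 ^ N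

/-- The nonnegative differences of elements of `S`; subtraction is truncated, which only
contributes the difference `0`. -/
def nonnegDiffs (S : Finset ℕ) : Finset ℕ := Finset.image₂ (· - ·) S S

lemma mem_nonnegDiffs {S : Finset ℕ} {k : ℕ} :
    k ∈ nonnegDiffs S ↔ ∃ x ∈ S, ∃ y ∈ S, x - y = k := by
  simp [nonnegDiffs, Finset.mem_image₂]

lemma missDiff_add_card_nonnegDiffs {n : ℕ} {S : Finset ℕ} (hS : S ⊆ Finset.range n)
    (hne : S.Nonempty) : missDiff S 0 ((n : ℤ) - 1) + (nonnegDiffs S).card = n := by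
  classical
  have hsub : nonnegDiffs S ⊆ Finset.range n := by
    intro k hk
    obtain ⟨x, hx, y, -, rfl⟩ := mem_nonnegDiffs.1 hk
    have := Finset.mem_range.1 (hS hx)
    simp only [Finset.mem_range]
    omega
  have hmiss : missDiff S 0 ((n : ℤ) - 1) = (Finset.range n \ nonnegDiffs S).card := by
    unfold missDiff
    symm
    refine Finset.card_bij (fun k _ => (k : ℤ)) ?_ (fun _ _ _ _ h => Int.ofNat.inj h) ?_
    · intro k hk
      simp only [Finset.mem_sdiff, Finset.mem_range, mem_nonnegDiffs, Finset.mem_filter,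
        Finset.mem_Icc] at hk ⊢
      refine ⟨⟨by omega, by omega⟩, ?_⟩
      rintro ⟨x, hx, y, hy, h⟩
      exact hk.2 ⟨x, hx, y, hy, by omega⟩
    · intro k hk
      simp only [Finset.mem_filter, Finset.mem_Icc] at hk
      obtain ⟨⟨h0, h1⟩, h⟩ := hk
      lift k to ℕ using h0
      refine ⟨k, ?_, rfl⟩
      simp only [Finset.mem_sdiff, Finset.mem_range, mem_nonnegDiffs]
      refine ⟨by omega, ?_⟩
      rintro ⟨x, hx, y, hy, hxy⟩
      obtain ⟨z, hz⟩ := hne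
      rcases Nat.eq_zero_or_pos k with rfl | hk
      · exact h ⟨z, hz, z, hz, by simp⟩
      · exact h ⟨x, hx, y, hy, by omega⟩
  have := Finset.card_sdiff_add_card_eq_card hsub
  rw [Finset.card_range] at this
  omega

lemma exists_sorted_of_card_eq_five {D : Finset ℕ} (h : D.card = 5) :
    ∃ a b c d e, a < b ∧ b < c ∧ c < d ∧ d < e ∧
      ∀ x, x ∈ D ↔ x = a ∨ x = b ∨ x = c ∨ x = d ∨ x = e := by
  have hm := (D.orderEmbOfFin h).strictMono
  refine ⟨D.orderEmbOfFin h 0, D.orderEmbOfFin h 1, D.orderEmbOfFin h 2, D.orderEmbOfFin h 3,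
    D.orderEmbOfFin h 4, hm (by decide), hm (by decide), hm (by decide), hm (by decide), ?_⟩
  intro x
  rw [← Finset.mem_coe, ← Finset.range_orderEmbOfFin D h]
  simp only [Set.mem_range, Fin.exists_fin_succ, eq_comm (a := x)]
  simp

lemma card_nonnegDiffs_triple {m x : ℕ} (hx : 0 < x) (hxm : x < m) (h : 2 * x ≠ m) :
    (nonnegDiffs {0, x, m}).card = 4 := by
  have : nonnegDiffs {0, x, m} = {0, x, m - x, m} := by
    ext k
    simp only [mem_nonnegDiffs, Finset.mem_insert, Finset.mem_singleton, exists_eq_or_imp,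
      exists_eq_left]
    omega
  rw [this, Finset.card_insert_of_notMem, Finset.card_insert_of_notMem,
    Finset.card_insert_of_notMem, Finset.card_singleton] <;>
    simp only [Finset.mem_insert, Finset.mem_singleton] <;> omega

/-- The sets spanning `[0, m]` with exactly five nonnegative differences. -/
lemma eq_of_card_nonnegDiffs_eq_five {m : ℕ} {S : Finset ℕ} (hS : ∀ x ∈ S, x ≤ m) (h0 : 0 ∈ S)
    (hm : m ∈ S) (h : (nonnegDiffs S).card = 5) :
    (∃ x ∈ Finset.Icc 1 ((m - 1) / 2), S = {0, x, m - x, m}) ∨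
      S = {0, m / 4, 2 * (m / 4), m} ∨ S = {0, 2 * (m / 4), 3 * (m / 4), m} ∨
      S = {0, m / 4, 2 * (m / 4), 3 * (m / 4), m} := by
  obtain ⟨z, a, b, c, e, hza, hab, hbc, hce, hD⟩ := exists_sorted_of_card_eq_five h
  have hdiff : ∀ x ∈ S, ∀ y ∈ S, x - y = z ∨ x - y = a ∨ x - y = b ∨ x - y = c ∨ x - y = e :=
    fun x hx y hy => (hD _).1 (mem_nonnegDiffs.2 ⟨x, hx, y, hy, rfl⟩)
  have hex : ∀ k, (k = z ∨ k = a ∨ k = b ∨ k = c ∨ k = e) → ∃ x ∈ S, ∃ y ∈ S, x - y = k :=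
    fun k hk => mem_nonnegDiffs.1 ((hD k).2 hk)
  have hz : z = 0 := by have := hdiff 0 h0 0 h0; omega
  have he : e = m := by
    have h1 := hdiff m hm 0 h0
    obtain ⟨x, hx, y, -, hxy⟩ := hex e (by simp)
    have := hS x hx
    omega
  subst hz he
  have hmem : ∀ x ∈ S, x = 0 ∨ x = a ∨ x = b ∨ x = c ∨ x = e := fun x hx => hdiff x hx 0 h0
  have hext : ∀ T : Finset ℕ, (0 ∈ T ∧ e ∈ T ∧ (a ∈ T ↔ a ∈ S) ∧ (b ∈ T ↔ b ∈ S) ∧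
      (c ∈ T ↔ c ∈ S) ∧ ∀ x ∈ T, x = 0 ∨ x = a ∨ x = b ∨ x = c ∨ x = e) → S = T := by
    rintro T ⟨h0', hm', ha, hb, hc, hT⟩
    ext x
    constructor
    · intro hx
      rcases hmem x hx with rfl | rfl | rfl | rfl | rfl <;> tauto
    · intro hx
      rcases hT x hx with rfl | rfl | rfl | rfl | rfl <;> tauto
  have hex' : ∀ k, 0 < k → (k = 0 ∨ k = a ∨ k = b ∨ k = c ∨ k = e) →
      (a ∈ S ∧ k = a) ∨ (b ∈ S ∧ k = b) ∨ (c ∈ S ∧ k = c) ∨ k = e ∨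
      (a ∈ S ∧ k = e - a) ∨ (b ∈ S ∧ k = e - b) ∨ (c ∈ S ∧ k = e - c) ∨
      (a ∈ S ∧ b ∈ S ∧ k = b - a) ∨ (a ∈ S ∧ c ∈ S ∧ k = c - a) ∨
      (b ∈ S ∧ c ∈ S ∧ k = c - b) := by
    intro k hk hkD
    obtain ⟨x, hx, y, hy, rfl⟩ := hex k hkD
    clear hkD hex hdiff hD hext
    rcases hmem x hx with rfl | rfl | rfl | rfl | rfl <;>
      rcases hmem y hy with rfl | rfl | rfl | rfl | rfl <;>
      first | omega | simp [*]
  have ha := hex' a (by omega) (by simp)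
  have hb := hex' b (by omega) (by simp)
  have hc := hex' c (by omega) (by simp)
  have hea := fun h => hdiff e hm a h
  have heb := fun h => hdiff e hm b h
  have hec := fun h => hdiff e hm c h
  have hba := fun h h' => hdiff b h a h'
  have hca := fun h h' => hdiff c h a h'
  have hcb := fun h h' => hdiff c h b h'
  by_cases hSa : a ∈ S <;> by_cases hSb : b ∈ S <;> by_cases hSc : c ∈ S <;>
    simp only [hSa, hSb, hSc, true_and, false_and, and_false, or_false, false_or,
      forall_true_left, iff_true, iff_false]
      at ha hb hc hea heb hec hba hca hcb hext
  · have habc : a = e / 4 ∧ b = 2 * (e / 4) ∧ c = 3 * (e / 4) := by omega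
    refine Or.inr (Or.inr (Or.inr (hext _ ?_)))
    simp only [Finset.mem_insert, Finset.mem_singleton]
    refine ⟨by simp, by simp, ?_, ?_, ?_, fun x hx => ?_⟩ <;> omega
  · have hpq : a + b = e ∨ (a = e / 4 ∧ b = 2 * (e / 4)) ∨
        (a = 2 * (e / 4) ∧ b = 3 * (e / 4)) := by omega
    rcases hpq with hpq | hpq | hpq
    · refine Or.inl ⟨a, by simp only [Finset.mem_Icc]; omega, hext _ ?_⟩
      simp only [Finset.mem_insert, Finset.mem_singleton]
      refine ⟨by simp, by simp, ?_, ?_, ?_, fun x hx => ?_⟩ <;> omega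
    · refine Or.inr (Or.inl (hext _ ?_))
      simp only [Finset.mem_insert, Finset.mem_singleton]
      refine ⟨by simp, by simp, ?_, ?_, ?_, fun x hx => ?_⟩ <;> omega
    · refine Or.inr (Or.inr (Or.inl (hext _ ?_)))
      simp only [Finset.mem_insert, Finset.mem_singleton]
      refine ⟨by simp, by simp, ?_, ?_, ?_, fun x hx => ?_⟩ <;> omega
  · have hpq : a + c = e ∨ (a = e / 4 ∧ c = 2 * (e / 4)) ∨
        (a = 2 * (e / 4) ∧ c = 3 * (e / 4)) := by omega
    rcases hpq with hpq | hpq | hpq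
    · refine Or.inl ⟨a, by simp only [Finset.mem_Icc]; omega, hext _ ?_⟩
      simp only [Finset.mem_insert, Finset.mem_singleton]
      refine ⟨by simp, by simp, ?_, ?_, ?_, fun x hx => ?_⟩ <;> first | omega | simp
    · refine Or.inr (Or.inl (hext _ ?_))
      simp only [Finset.mem_insert, Finset.mem_singleton]
      refine ⟨by simp, by simp, ?_, ?_, ?_, fun x hx => ?_⟩ <;> omega
    · refine Or.inr (Or.inr (Or.inl (hext _ ?_)))
      simp only [Finset.mem_insert, Finset.mem_singleton]
      refine ⟨by simp, by simp, ?_, ?_, ?_, fun x hx => ?_⟩ <;> omega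
  · omega
  · have hpq : b + c = e ∨ (b = e / 4 ∧ c = 2 * (e / 4)) ∨
        (b = 2 * (e / 4) ∧ c = 3 * (e / 4)) := by omega
    rcases hpq with hpq | hpq | hpq
    · refine Or.inl ⟨b, by simp only [Finset.mem_Icc]; omega, hext _ ?_⟩
      simp only [Finset.mem_insert, Finset.mem_singleton]
      refine ⟨by simp, by simp, ?_, ?_, ?_, fun x hx => ?_⟩ <;> first | omega | simp
    · refine Or.inr (Or.inl (hext _ ?_))
      simp only [Finset.mem_insert, Finset.mem_singleton]
      refine ⟨by simp, by simp, ?_, ?_, ?_, fun x hx => ?_⟩ <;> omega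
    · refine Or.inr (Or.inr (Or.inl (hext _ ?_)))
      simp only [Finset.mem_insert, Finset.mem_singleton]
      refine ⟨by simp, by simp, ?_, ?_, ?_, fun x hx => ?_⟩ <;> omega
  · omega
  · omega
  · omega

/-- For every integer `n ≥ 11`,
`P(f⁻_{[0,n-1]}(R_n'') = n-4) - P(f⁻_{[0,n-1]}(R_n'') = n-5) ≥ (n-10)/2^{n-1} > 0`. -/
theorem missing_diffs_tail_blip (n : ℕ) (hn : 11 ≤ n) :
    pR'' n (fun S => missDiff S 0 ((n : ℤ) - 1) = n - 4) -
        pR'' n (fun S => missDiff S 0 ((n : ℤ) - 1) = n - 5) ≥ ((n : ℝ) - 10) / 2 ^ (n - 1) ∧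
      ((n : ℝ) - 10) / 2 ^ (n - 1) > 0 := by
  classical
  have hn' : (11 : ℝ) ≤ n := by exact_mod_cast hn
  refine ⟨?_, div_pos (by linarith) (by positivity)⟩
  obtain ⟨m, rfl⟩ : ∃ m, n = m + 1 := ⟨n - 1, by omega⟩
  have hprob : ∀ j ≤ 5,
      pR'' (m + 1) (fun S => missDiff S 0 (((m + 1 : ℕ) : ℤ) - 1) = m + 1 - j) =
        (((Finset.range (m + 1)).powerset.filter
          (fun S => 0 ∈ S ∧ m ∈ S ∧ (nonnegDiffs S).card = j)).card : ℝ) / 2 ^ (m + 1 - 2) := by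
    intro j hj
    unfold pR''
    congr 3
    ext S
    simp only [Finset.mem_filter, Finset.mem_powerset, Nat.add_sub_cancel]
    refine and_congr_right fun hS => and_congr_right fun h0 => and_congr_right fun _ => ?_
    have := missDiff_add_card_nonnegDiffs hS ⟨0, h0⟩
    omega
  rw [hprob 4 (by norm_num), hprob 5 le_rfl]
  set A := (Finset.range (m + 1)).powerset.filter
    (fun S => 0 ∈ S ∧ m ∈ S ∧ (nonnegDiffs S).card = 4) with hA
  set B := (Finset.range (m + 1)).powerset.filter
    (fun S => 0 ∈ S ∧ m ∈ S ∧ (nonnegDiffs S).card = 5) with hB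
  have hAcard : m - 1 - (if 2 ∣ m then 1 else 0) ≤ A.card := by
    have hle : (((Finset.Icc 1 (m - 1)).filter (fun x => 2 * x ≠ m)).image
        (fun x => ({0, x, m} : Finset ℕ))).card ≤ A.card := by
      refine Finset.card_le_card fun S hS => ?_
      simp only [Finset.mem_image, Finset.mem_filter, Finset.mem_Icc] at hS
      obtain ⟨x, ⟨⟨h1, h2⟩, h3⟩, rfl⟩ := hS
      rw [hA, Finset.mem_filter, Finset.mem_powerset]
      refine ⟨?_, by simp, by simp, card_nonnegDiffs_triple (by omega) (by omega) h3⟩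
      intro y hy
      simp only [Finset.mem_insert, Finset.mem_singleton] at hy
      simp only [Finset.mem_range]
      omega
    rw [Finset.card_image_of_injOn] at hle
    · refine le_trans ?_ hle
      have herase : (Finset.Icc 1 (m - 1)).filter (fun x => 2 * x ≠ m) =
          if 2 ∣ m then (Finset.Icc 1 (m - 1)).erase (m / 2) else Finset.Icc 1 (m - 1) := by
        split_ifs <;> ext x <;>
          simp only [Finset.mem_filter, Finset.mem_erase, Finset.mem_Icc] <;> omega
      rw [herase]
      split_ifs
      · have := Finset.pred_card_le_card_erase (s := Finset.Icc 1 (m - 1)) (a := m / 2)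
        simpa using this
      · simp
    · intro x hx y hy hxy
      simp only [Finset.coe_filter, Set.mem_ofPred_eq, Finset.mem_Icc] at hx hy
      have : x ∈ ({0, y, m} : Finset ℕ) := by
        rw [← show ({0, x, m} : Finset ℕ) = {0, y, m} from hxy]
        simp
      simp only [Finset.mem_insert, Finset.mem_singleton] at this
      omega
  have hBcard : B.card ≤ (m - 1) / 2 + 3 := by
    have hsub : B ⊆ (Finset.Icc 1 ((m - 1) / 2)).image
        (fun x => ({0, x, m - x, m} : Finset ℕ)) ∪
        {{0, m / 4, 2 * (m / 4), m}, {0, 2 * (m / 4), 3 * (m / 4), m},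
          {0, m / 4, 2 * (m / 4), 3 * (m / 4), m}} := by
      intro S hS
      rw [hB, Finset.mem_filter, Finset.mem_powerset] at hS
      obtain ⟨hSm, h0, hm, h⟩ := hS
      have hle : ∀ x ∈ S, x ≤ m := fun x hx => by
        have := Finset.mem_range.1 (hSm hx)
        omega
      simp only [Finset.mem_union, Finset.mem_image, Finset.mem_insert, Finset.mem_singleton]
      rcases eq_of_card_nonnegDiffs_eq_five hle h0 hm h with ⟨x, hx, h⟩ | h
      · exact Or.inl ⟨x, hx, h.symm⟩
      · exact Or.inr h
    refine (Finset.card_le_card hsub).trans ((Finset.card_union_le _ _).trans ?_)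
    refine Nat.add_le_add (Finset.card_image_le.trans (by simp)) Finset.card_le_three
  have hAB : m + 2 * B.card ≤ 2 * A.card + 9 := by
    split_ifs at hAcard <;> omega
  have hAB' : (m : ℝ) + 2 * B.card ≤ 2 * A.card + 9 := by exact_mod_cast hAB
  have hpow : (2 : ℝ) ^ (m + 1 - 1) = 2 * 2 ^ (m + 1 - 2) := by
    rw [← pow_succ']
    congr 1
    omega
  rw [hpow, ge_iff_le, ← sub_div, ← div_div]
  gcongr
  push_cast
  linarith
end

section
/- For every integer n ≥ 4, P(f⁻_{[0,n−1]}(R_n'') = n−3) equals 1/2^{n−2} if n−1 is even, and equals 0 if n−1 is odd; moreover the event {f⁻_{[0,n−1]}(R_n'') = n−3} occurs exactly when R_n'' = {0, (n−1)/2, n−1}. -/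
open Finset Filter

open Classical in
/-- The differences of `R` lying in the integer interval `[a, b]`. -/
noncomputable def diffsIn (R : Finset ℕ) (a b : ℤ) : Finset ℤ :=
  (Finset.Icc a b).filter (fun k => ∃ x ∈ R, ∃ y ∈ R, (x : ℤ) - (y : ℤ) = k)

lemma mem_diffsIn {R : Finset ℕ} {a b k : ℤ} :
    k ∈ diffsIn R a b ↔ (a ≤ k ∧ k ≤ b) ∧ ∃ x ∈ R, ∃ y ∈ R, (x : ℤ) - (y : ℤ) = k := by
  classical
  simp [diffsIn]

lemma card_diffsIn_add_missDiff (R : Finset ℕ) (a b : ℤ) :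
    (diffsIn R a b).card + missDiff R a b = (b + 1 - a).toNat := by
  classical
  rw [diffsIn, missDiff, Finset.card_filter_add_card_filter_not, Int.card_Icc]

/-- A set with least element `0` and greatest element `m` has exactly three nonnegative
differences if and only if it is `{0, m / 2, m}` with `m` even. -/
lemma card_diffsIn_eq_three_iff {m : ℕ} (hm : 0 < m) {S : Finset ℕ}
    (hS : ∀ x ∈ S, x ≤ m) (h0 : 0 ∈ S) (hmS : m ∈ S) :
    (diffsIn S 0 m).card = 3 ↔ ∃ a : ℕ, m = 2 * a ∧ S = ({0, a, m} : Finset ℕ) := by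
  constructor
  · intro hc
    obtain ⟨a, haS, ha0, ham⟩ : ∃ a ∈ S, 0 < a ∧ a < m := by
      by_contra! h
      have hsub : diffsIn S 0 m ⊆ {0, (m : ℤ)} := by
        intro k hk
        obtain ⟨⟨hk0, hkm⟩, x, hx, y, hy, hxy⟩ := mem_diffsIn.1 hk
        have hx1 := h x hx
        have hy1 := h y hy
        have hx2 := hS x hx
        have hy2 := hS y hy
        simp only [Finset.mem_insert, Finset.mem_singleton]
        omega
      have := (Finset.card_le_card hsub).trans Finset.card_le_two
      omega
    have memD : ∀ x ∈ S, (x : ℤ) ∈ diffsIn S 0 m := fun x hx =>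
      mem_diffsIn.2 ⟨⟨by omega, by exact_mod_cast hS x hx⟩, x, hx, 0, h0, by simp⟩
    have hsub : ({0, (a : ℤ), (m : ℤ)} : Finset ℤ) ⊆ diffsIn S 0 m := by
      intro k hk
      simp only [Finset.mem_insert, Finset.mem_singleton] at hk
      rcases hk with rfl | rfl | rfl
      exacts [by simpa using memD 0 h0, memD a haS, memD m hmS]
    have hcard : ({0, (a : ℤ), (m : ℤ)} : Finset ℤ).card = 3 :=
      Finset.card_eq_three.2 ⟨0, a, m, by omega, by omega, by omega, rfl⟩
    have hD := Finset.eq_of_subset_of_card_le hsub (by omega)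
    have hma : (m : ℤ) - a ∈ diffsIn S 0 m :=
      mem_diffsIn.2 ⟨⟨by omega, by omega⟩, m, hmS, a, haS, rfl⟩
    rw [← hD] at hma memD
    simp only [Finset.mem_insert, Finset.mem_singleton] at hma memD
    refine ⟨a, by omega, ?_⟩
    ext x
    simp only [Finset.mem_insert, Finset.mem_singleton]
    constructor
    · intro hx
      have := memD x hx
      omega
    · rintro (rfl | rfl | rfl) <;> assumption
  · rintro ⟨a, hma, rfl⟩
    have hD : diffsIn {0, a, m} 0 m = ({0, (a : ℤ), (m : ℤ)} : Finset ℤ) := by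
      ext k
      simp only [mem_diffsIn, Finset.mem_insert, Finset.mem_singleton, exists_eq_or_imp,
        exists_eq_left]
      omega
    rw [hD]
    exact Finset.card_eq_three.2 ⟨0, a, m, by omega, by omega, by omega, rfl⟩

lemma missDiff_eq_sub_three_iff {n : ℕ} (hn : 4 ≤ n) {S : Finset ℕ}
    (hS : S ⊆ Finset.range n) (h0 : 0 ∈ S) (h1 : n - 1 ∈ S) :
    missDiff S 0 ((n : ℤ) - 1) = n - 3 ↔
      ∃ a : ℕ, n - 1 = 2 * a ∧ S = ({0, a, n - 1} : Finset ℕ) := by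
  have hle : ∀ x ∈ S, x ≤ n - 1 := fun x hx => by
    have := Finset.mem_range.1 (hS hx)
    omega
  have hcast : ((n - 1 : ℕ) : ℤ) = (n : ℤ) - 1 := by omega
  have hadd := card_diffsIn_add_missDiff S 0 ((n : ℤ) - 1)
  rw [← card_diffsIn_eq_three_iff (by omega) hle h0 h1, hcast]
  omega

/-- For every integer `n ≥ 4`, `P(f⁻_{[0,n-1]}(R_n'') = n-3)` equals
`1/2^{n-2}` if `n-1` is even and `0` if `n-1` is odd; moreover, for a set containing
`0` and `n-1`, the event `f⁻_{[0,n-1]} = n-3` occurs exactly when the set is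
`{0, (n-1)/2, n-1}` (with `(n-1)/2` an exact half, i.e. `n-1 = 2a` and the set is `{0,a,n-1}`). -/
theorem missing_diffs_n_sub_three (n : ℕ) (hn : 4 ≤ n) :
    (pR'' n (fun S => missDiff S 0 ((n : ℤ) - 1) = n - 3) =
      if Even (n - 1) then (1 / 2 ^ (n - 2) : ℝ) else 0) ∧
    (∀ S : Finset ℕ, S ⊆ Finset.range n → 0 ∈ S → n - 1 ∈ S →
      (missDiff S 0 ((n : ℤ) - 1) = n - 3 ↔
        ∃ a : ℕ, n - 1 = 2 * a ∧ S = ({0, a, n - 1} : Finset ℕ))) := by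
  refine ⟨?_, fun S hS h0 h1 => missDiff_eq_sub_three_iff hn hS h0 h1⟩
  classical
  unfold pR''
  split_ifs with he
  · obtain ⟨a, ha⟩ := he
    congr 1
    rw [Nat.cast_eq_one, Finset.card_eq_one]
    refine ⟨{0, a, n - 1}, ?_⟩
    ext S
    simp only [Finset.mem_filter, Finset.mem_powerset, Finset.mem_singleton]
    constructor
    · rintro ⟨hS, h0, h1, h⟩
      obtain ⟨b, hb, rfl⟩ := (missDiff_eq_sub_three_iff hn hS h0 h1).1 h
      obtain rfl : b = a := by omega
      rfl
    · rintro rfl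
      have hS : ({0, a, n - 1} : Finset ℕ) ⊆ Finset.range n := by
        intro x hx
        simp only [Finset.mem_insert, Finset.mem_singleton] at hx
        rw [Finset.mem_range]
        omega
      exact ⟨hS, by simp, by simp,
        (missDiff_eq_sub_three_iff hn hS (by simp) (by simp)).2 ⟨a, by omega, rfl⟩⟩
  · rw [div_eq_zero_iff, Nat.cast_eq_zero, Finset.card_eq_zero, Finset.eq_empty_iff_forall_notMem]
    left
    intro S hS'
    simp only [Finset.mem_filter] at hS'
    obtain ⟨hS, h0, h1, h⟩ := hS'
    obtain ⟨a, ha, -⟩ :=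
      (missDiff_eq_sub_three_iff hn (Finset.mem_powerset.1 hS) h0 h1).1 h
    exact he ⟨a, by omega⟩
end

section
/- For every integer n ≥ 11, P(f⁻_{[0,n−1]}(R_n'') = n−4) = (n−2)/2^{n−2} − [2 ∣ n−1]/2^{n−2} + [3 ∣ n−1]/2^{n−2}, where [d ∣ n−1] is 1 if d divides n−1 and 0 otherwise. -/
open Finset Filter

open Classical in
/-- The differences of `S` that lie in `{0, …, n - 1}`. -/
noncomputable def natDiffs (n : ℕ) (S : Finset ℕ) : Finset ℕ :=
  (Finset.range n).filter (fun k => ∃ x ∈ S, ∃ y ∈ S, x = y + k)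

lemma mem_natDiffs {n k : ℕ} {S : Finset ℕ} :
    k ∈ natDiffs n S ↔ k < n ∧ ∃ x ∈ S, ∃ y ∈ S, x = y + k := by
  simp [natDiffs]

lemma missDiff_add_card_natDiffs (n : ℕ) (S : Finset ℕ) :
    missDiff S 0 ((n : ℤ) - 1) + (natDiffs n S).card = n := by
  classical
  have h : (natDiffs n S).card = ((Finset.Icc (0 : ℤ) ((n : ℤ) - 1)).filter
      (fun k => ∃ x ∈ S, ∃ y ∈ S, (x : ℤ) - (y : ℤ) = k)).card := by
    refine Finset.card_bij (fun k _ => (k : ℤ)) ?_ ?_ ?_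
    · intro k hk
      obtain ⟨hk, x, hx, y, hy, hxy⟩ := mem_natDiffs.1 hk
      simp only [Finset.mem_filter, Finset.mem_Icc]
      exact ⟨by omega, x, hx, y, hy, by omega⟩
    · intro a _ b _ hab
      exact_mod_cast hab
    · intro k hk
      simp only [Finset.mem_filter, Finset.mem_Icc] at hk
      obtain ⟨hk, x, hx, y, hy, hxy⟩ := hk
      exact ⟨k.toNat, mem_natDiffs.2 ⟨by omega, x, hx, y, hy, by omega⟩, by omega⟩
  have h2 := Finset.card_filter_add_card_filter_not (s := Finset.Icc (0 : ℤ) ((n : ℤ) - 1))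
    (fun k => ∃ x ∈ S, ∃ y ∈ S, (x : ℤ) - (y : ℤ) = k)
  have h3 : (Finset.Icc (0 : ℤ) ((n : ℤ) - 1)).card = n := by simp
  rw [h3] at h2
  rw [h, missDiff, add_comm]
  convert h2

lemma subset_natDiffs {n : ℕ} {S : Finset ℕ} (hS : S ⊆ Finset.range n) (h0 : 0 ∈ S) :
    S ⊆ natDiffs n S := fun x hx =>
  mem_natDiffs.2 ⟨Finset.mem_range.1 (hS hx), x, hx, 0, h0, by omega⟩

lemma natDiffs_three {m a : ℕ} (h : a ≤ m) :
    natDiffs (m + 1) {0, a, m} = {0, a, m - a, m} := by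
  ext k
  simp only [mem_natDiffs, Finset.mem_insert, Finset.mem_singleton, exists_eq_or_imp,
    exists_eq_left]
  omega

lemma natDiffs_four (c : ℕ) :
    natDiffs (3 * c + 1) {0, c, 2 * c, 3 * c} = {0, c, 2 * c, 3 * c} := by
  ext k
  simp only [mem_natDiffs, Finset.mem_insert, Finset.mem_singleton, exists_eq_or_imp,
    exists_eq_left]
  omega

/-- A set with least element `0` and greatest element `m` has exactly four nonnegative differences
iff it is `{0, a, m}` with `a` not the midpoint, or a four-term arithmetic progression. -/
lemma card_natDiffs_eq_four_iff {m : ℕ} (hm : 0 < m) {S : Finset ℕ}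
    (hS : S ⊆ Finset.range (m + 1)) (h0 : 0 ∈ S) (h1 : m ∈ S) :
    (natDiffs (m + 1) S).card = 4 ↔
      (∃ a, (0 < a ∧ a < m ∧ 2 * a ≠ m) ∧ S = {0, a, m}) ∨
        ∃ c, m = 3 * c ∧ S = {0, c, 2 * c, 3 * c} := by
  constructor
  · intro hD
    have hsub := subset_natDiffs hS h0
    obtain ⟨T, hT⟩ : ∃ T, T = (S.erase 0).erase m := ⟨_, rfl⟩
    have hTS : S = insert 0 (insert m T) := by
      rw [hT, Finset.insert_erase (Finset.mem_erase.2 ⟨hm.ne', h1⟩), Finset.insert_erase h0]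
    have hTlt : ∀ x ∈ T, 0 < x ∧ x < m := by
      intro x hx
      simp only [hT, Finset.mem_erase] at hx
      have := Finset.mem_range.1 (hS hx.2.2)
      omega
    have hcard : S.card = T.card + 2 := by
      rw [hT, Finset.card_erase_of_mem (Finset.mem_erase.2 ⟨hm.ne', h1⟩),
        Finset.card_erase_of_mem h0]
      have : ({0, m} : Finset ℕ).card ≤ S.card := Finset.card_le_card (by
        intro x hx
        simp only [Finset.mem_insert, Finset.mem_singleton] at hx
        rcases hx with rfl | rfl <;> assumption)
      rw [Finset.card_pair hm.ne] at this
      omega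
    have hle := Finset.card_le_card hsub
    have hT2 : T.card = 0 ∨ T.card = 1 ∨ T.card = 2 := by omega
    rcases hT2 with hT0 | hT1 | hT2
    · rw [Finset.card_eq_zero] at hT0
      have hS0 : S = {0, 0, m} := by rw [hTS, hT0]; simp
      rw [hS0, natDiffs_three (Nat.zero_le m)] at hD
      have : ({0, 0, m - 0, m} : Finset ℕ).card ≤ 2 := by
        simpa using Finset.card_le_two (a := 0) (b := m)
      omega
    · obtain ⟨a, ha⟩ := Finset.card_eq_one.1 hT1
      have hS1 : S = {0, a, m} := by rw [hTS, ha, Finset.pair_comm]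
      obtain ⟨ha0, ham⟩ := hTlt a (by simp [ha])
      refine Or.inl ⟨a, ⟨ha0, ham, fun h => ?_⟩, hS1⟩
      rw [hS1, natDiffs_three ham.le, show m - a = a by omega] at hD
      have : ({0, a, a, m} : Finset ℕ).card ≤ 3 := by
        simpa using Finset.card_le_three (a := 0) (b := a) (c := m)
      omega
    · have hpair : ∃ a b, a < b ∧ T = {a, b} := by
        obtain ⟨a, b, hab, h⟩ := Finset.card_eq_two.1 hT2
        rcases lt_or_gt_of_ne hab with hlt | hlt
        · exact ⟨a, b, hlt, h⟩
        · exact ⟨b, a, hlt, h.trans (Finset.pair_comm a b)⟩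
      obtain ⟨a, b, hab, h⟩ := hpair
      obtain ⟨ha0, ham⟩ := hTlt a (by simp [h])
      obtain ⟨hb0, hbm⟩ := hTlt b (by simp [h])
      have hmem : ∀ x, x ∈ S ↔ x = 0 ∨ x = m ∨ x = a ∨ x = b := by
        intro x
        simp [hTS, h]
      have hSD : S = natDiffs (m + 1) S := Finset.eq_of_subset_of_card_le hsub (by omega)
      have hba : b - a ∈ S := by
        rw [hSD]
        exact mem_natDiffs.2
          ⟨by omega, b, (hmem b).2 (by simp), a, (hmem a).2 (by simp), by omega⟩
      have hma : m - a ∈ S := by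
        rw [hSD]
        exact mem_natDiffs.2 ⟨by omega, m, h1, a, (hmem a).2 (by simp), by omega⟩
      rw [hmem] at hba hma
      refine Or.inr ⟨a, by omega, ?_⟩
      ext x
      rw [hmem]
      simp only [Finset.mem_insert, Finset.mem_singleton]
      omega
  · rintro (⟨a, ⟨ha0, ham, h2⟩, rfl⟩ | ⟨c, rfl, rfl⟩)
    · rw [natDiffs_three ham.le]
      exact Finset.card_eq_four.2 ⟨0, a, m - a, m, by omega, by omega, by omega, by omega, by omega,
        by omega, rfl⟩
    · rw [natDiffs_four]
      exact Finset.card_eq_four.2 ⟨0, c, 2 * c, 3 * c, by omega, by omega, by omega, by omega,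
        by omega, by omega, rfl⟩

lemma card_two_mul_ne {m : ℕ} (hm : 0 < m) :
    ((Finset.Ioo 0 m).filter (fun a => 2 * a ≠ m)).card + (if 2 ∣ m then 1 else 0) = m - 1 := by
  have h := Finset.card_filter_add_card_filter_not (s := Finset.Ioo 0 m) (fun a => 2 * a = m)
  have hc : ((Finset.Ioo 0 m).filter (fun a => 2 * a = m)).card = if 2 ∣ m then 1 else 0 := by
    split_ifs with h2
    · rw [Finset.card_eq_one]
      refine ⟨m / 2, ?_⟩
      ext x
      simp only [Finset.mem_filter, Finset.mem_Ioo, Finset.mem_singleton]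
      omega
    · rw [Finset.card_eq_zero, Finset.filter_eq_empty_iff]
      intro x _
      omega
  rw [hc, Nat.card_Ioo] at h
  simp only [ne_eq]
  omega

open Classical in
lemma card_filter_card_natDiffs_eq_four {m : ℕ} (hm : 0 < m) :
    ((Finset.range (m + 1)).powerset.filter
      (fun S => 0 ∈ S ∧ m ∈ S ∧ (natDiffs (m + 1) S).card = 4)).card + (if 2 ∣ m then 1 else 0) =
      (m - 1) + if 3 ∣ m then 1 else 0 := by
  have hset : (Finset.range (m + 1)).powerset.filter
      (fun S => 0 ∈ S ∧ m ∈ S ∧ (natDiffs (m + 1) S).card = 4) =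
      ((Finset.Ioo 0 m).filter (fun a => 2 * a ≠ m)).image (fun a => ({0, a, m} : Finset ℕ)) ∪
        if 3 ∣ m then {{0, m / 3, 2 * (m / 3), 3 * (m / 3)}} else ∅ := by
    ext S
    simp only [Finset.mem_filter, Finset.mem_powerset, Finset.mem_union, Finset.mem_image,
      Finset.mem_Ioo]
    constructor
    · rintro ⟨hS, h0, h1, hD⟩
      rcases (card_natDiffs_eq_four_iff hm hS h0 h1).1 hD with ⟨a, ha, rfl⟩ | ⟨c, rfl, rfl⟩
      · exact Or.inl ⟨a, by omega, rfl⟩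
      · right
        simp
    · intro h
      have h' : (∃ a, (0 < a ∧ a < m ∧ 2 * a ≠ m) ∧ S = {0, a, m}) ∨
          ∃ c, m = 3 * c ∧ S = {0, c, 2 * c, 3 * c} := by
        rcases h with ⟨a, ha, rfl⟩ | h
        · exact Or.inl ⟨a, by omega, rfl⟩
        · split_ifs at h with h3
          · exact Or.inr ⟨m / 3, by omega, Finset.mem_singleton.1 h⟩
          · simp at h
      have hS : S ⊆ Finset.range (m + 1) ∧ 0 ∈ S ∧ m ∈ S := by
        rcases h' with ⟨a, ha, rfl⟩ | ⟨c, rfl, rfl⟩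
        · refine ⟨fun x hx => ?_, by simp, by simp⟩
          simp only [Finset.mem_insert, Finset.mem_singleton] at hx
          rw [Finset.mem_range]
          omega
        · refine ⟨fun x hx => ?_, by simp, by simp⟩
          simp only [Finset.mem_insert, Finset.mem_singleton] at hx
          rw [Finset.mem_range]
          omega
      exact ⟨hS.1, hS.2.1, hS.2.2, (card_natDiffs_eq_four_iff hm hS.1 hS.2.1 hS.2.2).2 h'⟩
  have hdisj : Disjoint
      (((Finset.Ioo 0 m).filter (fun a => 2 * a ≠ m)).image (fun a => ({0, a, m} : Finset ℕ)))
      (if 3 ∣ m then {{0, m / 3, 2 * (m / 3), 3 * (m / 3)}} else ∅) := by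
    split_ifs with h3
    · rw [Finset.disjoint_singleton_right, Finset.mem_image]
      rintro ⟨a, -, h⟩
      have h4 : ({0, m / 3, 2 * (m / 3), 3 * (m / 3)} : Finset ℕ).card = 4 :=
        Finset.card_eq_four.2 ⟨_, _, _, _, by omega, by omega, by omega, by omega,
          by omega, by omega, rfl⟩
      have := Finset.card_le_three (a := 0) (b := a) (c := m)
      rw [h] at this
      omega
    · simp
  have hinj : Set.InjOn (fun a => ({0, a, m} : Finset ℕ))
      ((Finset.Ioo 0 m).filter (fun a => 2 * a ≠ m)) := by
    intro a ha b _ hab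
    simp only [Finset.coe_filter, Finset.mem_Ioo, Set.mem_ofPred_eq] at ha
    have : a ∈ ({0, b, m} : Finset ℕ) := by
      rw [← show ({0, a, m} : Finset ℕ) = {0, b, m} from hab]
      simp
    simp only [Finset.mem_insert, Finset.mem_singleton] at this
    omega
  have hc : (if 3 ∣ m then {{0, m / 3, 2 * (m / 3), 3 * (m / 3)}} else ∅ :
      Finset (Finset ℕ)).card = if 3 ∣ m then 1 else 0 := by
    split_ifs <;> simp
  rw [hset, Finset.card_union_of_disjoint hdisj, Finset.card_image_of_injOn hinj, hc]
  have := card_two_mul_ne hm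
  omega

/-- For every integer `n ≥ 11`,
`P(f⁻_{[0,n-1]}(R_n'') = n-4) = (n-2)/2^{n-2} - [2 ∣ n-1]/2^{n-2} + [3 ∣ n-1]/2^{n-2}`. -/
theorem missing_diffs_n_sub_four (n : ℕ) (hn : 11 ≤ n) :
    pR'' n (fun S => missDiff S 0 ((n : ℤ) - 1) = n - 4) =
      ((n : ℝ) - 2) / 2 ^ (n - 2) - (if 2 ∣ n - 1 then (1 : ℝ) else 0) / 2 ^ (n - 2) +
        (if 3 ∣ n - 1 then (1 : ℝ) else 0) / 2 ^ (n - 2) := by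
  classical
  obtain ⟨m, rfl⟩ : ∃ m, n = m + 1 := ⟨n - 1, by omega⟩
  have hiff : ∀ S : Finset ℕ, missDiff S 0 (((m + 1 : ℕ) : ℤ) - 1) = m + 1 - 4 ↔
      (natDiffs (m + 1) S).card = 4 := by
    intro S
    have := missDiff_add_card_natDiffs (m + 1) S
    omega
  have hcount := card_filter_card_natDiffs_eq_four (m := m) (by omega)
  have hcast := congrArg (Nat.cast : ℕ → ℝ) hcount
  push_cast [Nat.cast_sub (show 1 ≤ m by omega)] at hcast
  unfold pR''
  simp only [hiff, Nat.add_sub_cancel]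
  rw [← sub_div, ← add_div]
  congr 1
  push_cast
  linarith
end

section
/- For every integer n ≥ 11, P(f⁻_{[0,n−1]}(R_n'') = n−5) = (⌈(n−1)/2⌉ − 1)/2^{n−2} − [3 ∣ n−1]/2^{n−2} + 3·[4 ∣ n−1]/2^{n−2}, where [d ∣ n−1] is 1 if d divides n−1 and 0 otherwise. -/
open Finset Filter

open Classical in
/-- The positive differences of `S` in `[1, m]`. -/
noncomputable def posDiffs (S : Finset ℕ) (m : ℕ) : Finset ℕ :=
  (Finset.Icc 1 m).filter (fun d => ∃ x ∈ S, x + d ∈ S)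

lemma mem_posDiffs {S : Finset ℕ} {m d : ℕ} :
    d ∈ posDiffs S m ↔ (1 ≤ d ∧ d ≤ m) ∧ ∃ x ∈ S, x + d ∈ S := by
  simp [posDiffs]

lemma missDiff_add_card_posDiffs {S : Finset ℕ} (m : ℕ) (h0 : 0 ∈ S) :
    missDiff S 0 (m : ℤ) + ((posDiffs S m).card + 1) = m + 1 := by
  classical
  have hpres : (Finset.Icc (0 : ℤ) m).filter (fun k => ∃ x ∈ S, ∃ y ∈ S, (x : ℤ) - (y : ℤ) = k)
      = (insert 0 (posDiffs S m)).image (fun d : ℕ => (d : ℤ)) := by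
    ext k
    simp only [Finset.mem_filter, Finset.mem_Icc, Finset.mem_image, Finset.mem_insert,
      mem_posDiffs]
    constructor
    · rintro ⟨⟨hk0, hkm⟩, x, hx, y, hy, rfl⟩
      refine ⟨x - y, ?_, by omega⟩
      by_cases hxy : x = y
      · left; omega
      · right
        refine ⟨by omega, y, hy, ?_⟩
        rwa [show y + (x - y) = x by omega]
    · rintro ⟨d, (rfl | ⟨⟨h1, h2⟩, x, hx, hxd⟩), rfl⟩
      · exact ⟨by simp, 0, h0, 0, h0, by simp⟩
      · exact ⟨by omega, x + d, hxd, x, hx, by push_cast; ring⟩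
  have hcard : ((Finset.Icc (0 : ℤ) m).filter
      (fun k => ∃ x ∈ S, ∃ y ∈ S, (x : ℤ) - (y : ℤ) = k)).card = (posDiffs S m).card + 1 := by
    rw [hpres, Finset.card_image_of_injective _ Nat.cast_injective,
      Finset.card_insert_of_notMem (by simp [mem_posDiffs])]
  have hsum := Finset.card_filter_add_card_filter_not (s := Finset.Icc (0 : ℤ) m)
    (fun k => ∃ x ∈ S, ∃ y ∈ S, (x : ℤ) - (y : ℤ) = k)
  rw [Int.card_Icc, hcard] at hsum
  unfold missDiff
  convert (add_comm _ _).trans hsum using 1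
  omega

lemma sub_mem_posDiffs {S : Finset ℕ} {m x y : ℕ} (hx : x ∈ S) (hy : y ∈ S) (hxy : x < y)
    (hym : y ≤ m) : y - x ∈ posDiffs S m :=
  mem_posDiffs.2 ⟨by omega, x, hx, by rwa [show x + (y - x) = y by omega]⟩

lemma posDiffs_pair (m : ℕ) : posDiffs {0, m} m ⊆ {m} := by
  intro d hd
  simp only [mem_posDiffs, Finset.mem_insert, Finset.mem_singleton] at hd ⊢
  obtain ⟨h, x, hx, hxd⟩ := hd
  omega

lemma posDiffs_triple {a m : ℕ} (ham : a < m) : posDiffs {0, a, m} m ⊆ {a, m, m - a} := by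
  intro d hd
  simp only [mem_posDiffs, Finset.mem_insert, Finset.mem_singleton] at hd ⊢
  obtain ⟨h, x, hx, hxd⟩ := hd
  omega

lemma posDiffs_quadruple {a b m : ℕ} (h1 : 0 < a) (h2 : a < b) (h3 : b < m) :
    posDiffs {0, a, b, m} m = {a, b, m, b - a, m - a, m - b} := by
  ext d
  constructor
  · intro hd
    simp only [mem_posDiffs, Finset.mem_insert, Finset.mem_singleton] at hd ⊢
    obtain ⟨h, x, hx, hxd⟩ := hd
    omega
  · simp only [Finset.mem_insert, Finset.mem_singleton]
    have key : ∀ x ∈ ({0, a, b, m} : Finset ℕ), ∀ y ∈ ({0, a, b, m} : Finset ℕ), x < y → y ≤ m →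
        y - x ∈ posDiffs {0, a, b, m} m := fun x hx y hy => sub_mem_posDiffs hx hy
    rintro (rfl | rfl | rfl | rfl | rfl | rfl)
    · simpa using key 0 (by simp) d (by simp) h1 (by omega)
    · simpa using key 0 (by simp) d (by simp) (by omega) (by omega)
    · simpa using key 0 (by simp) d (by simp) (by omega) (by omega)
    · exact key a (by simp) b (by simp) h2 h3.le
    · exact key a (by simp) m (by simp) (by omega) le_rfl
    · exact key b (by simp) m (by simp) h3 le_rfl

/-- A set of four naturals containing `p, q, r` distinct has at most one further element. -/
lemma eq_of_mem_of_card_eq_four {Q : Finset ℕ} (hQ : Q.card = 4) {p q r x y : ℕ} (hp : p ∈ Q)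
    (hq : q ∈ Q) (hr : r ∈ Q) (hpq : p < q) (hqr : q < r) (hx : x ∈ Q) (hy : y ∈ Q) :
    x = p ∨ x = q ∨ x = r ∨ y = p ∨ y = q ∨ y = r ∨ x = y := by
  by_contra! h
  obtain ⟨h1, h2, h3, h4, h5, h6, h7⟩ := h
  have hsub : ({p, q, r, x, y} : Finset ℕ) ⊆ Q := by
    intro z hz
    simp only [Finset.mem_insert, Finset.mem_singleton] at hz
    rcases hz with rfl | rfl | rfl | rfl | rfl <;> assumption
  have hcard : ({p, q, r, x, y} : Finset ℕ).card = 5 := by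
    rw [Finset.card_insert_of_notMem, Finset.card_eq_four.2
      ⟨q, r, x, y, by omega, by omega, by omega, by omega, by omega, by omega, rfl⟩]
    simp only [Finset.mem_insert, Finset.mem_singleton]
    omega
  have := Finset.card_le_card hsub
  omega

lemma card_posDiffs_quadruple {a b m : ℕ} (h1 : 0 < a) (h2 : a < b) (h3 : b < m) :
    (posDiffs {0, a, b, m} m).card = 4 ↔
      (a + b = m ∧ 3 * a ≠ m) ∨ (b = 2 * a ∧ m = 4 * a) ∨ (2 * b = 3 * a ∧ m = 2 * a) := by
  rw [posDiffs_quadruple h1 h2 h3]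
  constructor
  · intro hQ
    have key : ∀ x ∈ ({a, b, m, b - a, m - a, m - b} : Finset ℕ),
        ∀ y ∈ ({a, b, m, b - a, m - a, m - b} : Finset ℕ),
        x = a ∨ x = b ∨ x = m ∨ y = a ∨ y = b ∨ y = m ∨ x = y := fun x hx y hy =>
      eq_of_mem_of_card_eq_four hQ (by simp) (by simp) (by simp) h2 h3 hx hy
    have e1 := key (b - a) (by simp) (m - a) (by simp)
    have e2 := key (b - a) (by simp) (m - b) (by simp)
    have e3 := key (m - a) (by simp) (m - b) (by simp)
    have e4 : ¬ (a + b = m ∧ 3 * a = m) := by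
      rintro ⟨e, e'⟩
      have hsub : ({a, b, m, b - a, m - a, m - b} : Finset ℕ) ⊆ {a, b, m} := by
        intro z hz
        simp only [Finset.mem_insert, Finset.mem_singleton] at hz ⊢
        omega
      have := (Finset.card_le_card hsub).trans Finset.card_le_three
      omega
    omega
  · rintro (⟨e, e'⟩ | ⟨e, e'⟩ | ⟨e, e'⟩)
    · have : ({a, b, m, b - a, m - a, m - b} : Finset ℕ) = {a, b, m, b - a} := by
        ext z
        simp only [Finset.mem_insert, Finset.mem_singleton]
        omega
      rw [this, Finset.card_eq_four]
      exact ⟨a, b, m, b - a, by omega, by omega, by omega, by omega, by omega, by omega, rfl⟩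
    · have : ({a, b, m, b - a, m - a, m - b} : Finset ℕ) = {a, b, m, m - a} := by
        ext z
        simp only [Finset.mem_insert, Finset.mem_singleton]
        omega
      rw [this, Finset.card_eq_four]
      exact ⟨a, b, m, m - a, by omega, by omega, by omega, by omega, by omega, by omega, rfl⟩
    · have : ({a, b, m, b - a, m - a, m - b} : Finset ℕ) = {a, b, m, b - a} := by
        ext z
        simp only [Finset.mem_insert, Finset.mem_singleton]
        omega
      rw [this, Finset.card_eq_four]
      exact ⟨a, b, m, b - a, by omega, by omega, by omega, by omega, by omega, by omega, rfl⟩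

lemma card_posDiffs_quintuple {a b c m : ℕ} (h1 : 0 < a) (h2 : a < b) (h3 : b < c) (h4 : c < m) :
    (posDiffs {0, a, b, c, m} m).card = 4 ↔ b = 2 * a ∧ c = 3 * a ∧ m = 4 * a := by
  have key : ∀ x ∈ ({0, a, b, c, m} : Finset ℕ), ∀ y ∈ ({0, a, b, c, m} : Finset ℕ), x < y →
      y ≤ m → y - x ∈ posDiffs {0, a, b, c, m} m := fun x hx y hy => sub_mem_posDiffs hx hy
  have hsub : ({a, b, c, m} : Finset ℕ) ⊆ posDiffs {0, a, b, c, m} m := by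
    intro d hd
    simp only [Finset.mem_insert, Finset.mem_singleton] at hd
    exact key 0 (by simp) d (by simp; tauto) (by omega) (by omega)
  have hcard : ({a, b, c, m} : Finset ℕ).card = 4 :=
    Finset.card_eq_four.2
      ⟨a, b, c, m, by omega, by omega, by omega, by omega, by omega, by omega, rfl⟩
  constructor
  · intro hQ
    have hEq := Finset.eq_of_subset_of_card_le hsub (by omega)
    rw [← hEq] at key
    have e1 := key a (by simp) b (by simp) h2 (by omega)
    have e2 := key a (by simp) c (by simp) (by omega) (by omega)
    have e3 := key a (by simp) m (by simp) (by omega) (by omega)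
    have e4 := key b (by simp) m (by simp) (by omega) (by omega)
    simp only [Finset.mem_insert, Finset.mem_singleton] at e1 e2 e3 e4
    omega
  · rintro ⟨rfl, rfl, rfl⟩
    refine (congrArg _ (Finset.Subset.antisymm ?_ hsub)).trans hcard
    intro d hd
    simp only [mem_posDiffs, Finset.mem_insert, Finset.mem_singleton] at hd ⊢
    obtain ⟨h, x, hx, hxd⟩ := hd
    omega

lemma exists_lt_lt_eq_of_card_eq_three {T : Finset ℕ} (hT : T.card = 3) :
    ∃ a b c, a < b ∧ b < c ∧ T = {a, b, c} := by
  refine ⟨T.orderEmbOfFin hT 0, T.orderEmbOfFin hT 1, T.orderEmbOfFin hT 2, ?_, ?_, ?_⟩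
  · exact (T.orderEmbOfFin hT).strictMono (by decide)
  · exact (T.orderEmbOfFin hT).strictMono (by decide)
  · rw [← Finset.coe_inj, ← Finset.range_orderEmbOfFin T hT]
    ext x
    simp only [Set.mem_range, Fin.exists_fin_succ, Finset.coe_insert, Finset.coe_singleton,
      Set.mem_insert_iff, Set.mem_singleton_iff, eq_comm (a := x)]
    simp

lemma exists_lt_eq_of_card_eq_two {T : Finset ℕ} (hT : T.card = 2) :
    ∃ a b, a < b ∧ T = {a, b} := by
  obtain ⟨x, y, hxy, rfl⟩ := Finset.card_eq_two.1 hT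
  rcases lt_or_gt_of_ne hxy with h | h
  · exact ⟨x, y, h, rfl⟩
  · exact ⟨y, x, h, Finset.pair_comm x y⟩

lemma eq_of_card_posDiffs_eq_four {S : Finset ℕ} {m : ℕ} (hm : 0 < m) (hS : ∀ x ∈ S, x ≤ m)
    (h0 : 0 ∈ S) (hmS : m ∈ S) (hQ : (posDiffs S m).card = 4) :
    (∃ a b, 0 < a ∧ a < b ∧ b < m ∧ S = {0, a, b, m}) ∨
      ∃ a b c, 0 < a ∧ a < b ∧ b < c ∧ c < m ∧ S = {0, a, b, c, m} := by
  have hmem : m ∈ S.erase 0 := Finset.mem_erase.2 ⟨hm.ne', hmS⟩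
  obtain ⟨T, hT⟩ : ∃ T, T = (S.erase 0).erase m := ⟨_, rfl⟩
  have hST : S = insert 0 (insert m T) := by
    rw [hT, Finset.insert_erase hmem, Finset.insert_erase h0]
  have hTlt : ∀ x ∈ T, 0 < x ∧ x < m := by
    intro x hx
    rw [hT, Finset.mem_erase, Finset.mem_erase] at hx
    have := hS x hx.2.2
    omega
  have hle : (S.erase 0).card ≤ 4 := by
    rw [← hQ]
    refine Finset.card_le_card fun x hx => ?_
    rw [Finset.mem_erase] at hx
    simpa using sub_mem_posDiffs h0 hx.2 (Nat.pos_of_ne_zero hx.1) (hS x hx.2)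
  have hTcard : T.card ≤ 3 := by
    rw [hT, Finset.card_erase_of_mem hmem]
    omega
  obtain h | h | h | h : T.card = 0 ∨ T.card = 1 ∨ T.card = 2 ∨ T.card = 3 := by omega
  · obtain rfl := Finset.card_eq_zero.1 h
    have := Finset.card_le_card (posDiffs_pair m)
    rw [hST, insert_empty_eq] at hQ
    rw [hQ, Finset.card_singleton] at this
    omega
  · obtain ⟨a, rfl⟩ := Finset.card_eq_one.1 h
    have h3 := (Finset.card_le_card (posDiffs_triple (hTlt a (by simp)).2)).trans
      Finset.card_le_three
    rw [hST, Finset.pair_comm m a] at hQ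
    omega
  · obtain ⟨a, b, hab, rfl⟩ := exists_lt_eq_of_card_eq_two h
    refine Or.inl ⟨a, b, (hTlt a (by simp)).1, hab, (hTlt b (by simp)).2, hST.trans ?_⟩
    ext x
    simp only [Finset.mem_insert, Finset.mem_singleton]
    tauto
  · obtain ⟨a, b, c, hab, hbc, rfl⟩ := exists_lt_lt_eq_of_card_eq_three h
    refine Or.inr ⟨a, b, c, (hTlt a (by simp)).1, hab, hbc, (hTlt c (by simp)).2, hST.trans ?_⟩
    ext x
    simp only [Finset.mem_insert, Finset.mem_singleton]
    tauto

/-- The sets `{0, a, m - a, m}` with four distinct positive differences. -/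
def symmetricSets (m : ℕ) : Finset (Finset ℕ) :=
  ((Finset.Ico 1 ((m + 1) / 2)).filter (fun a => 3 * a ≠ m)).image
    (fun a => {0, a, m - a, m})

/-- The dilates by `q` of the subsets of `{0, …, 4}` containing `0, 2, 4` and at least one
other element. -/
def dilatedSets (q : ℕ) : Finset (Finset ℕ) :=
  {{0, q, 2 * q, 3 * q, 4 * q}, {0, q, 2 * q, 4 * q}, {0, 2 * q, 3 * q, 4 * q}}

lemma card_posDiffs_eq_four_iff {S : Finset ℕ} {m : ℕ} (hm : 0 < m) :
    ((∀ x ∈ S, x ≤ m) ∧ 0 ∈ S ∧ m ∈ S ∧ (posDiffs S m).card = 4) ↔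
      S ∈ symmetricSets m ∪ if 4 ∣ m then dilatedSets (m / 4) else ∅ := by
  rw [Finset.mem_union]
  constructor
  · rintro ⟨hS, h0, hmS, hQ⟩
    have of_dvd {q : ℕ} (hq : m = 4 * q) (h : S ∈ dilatedSets q) :
        S ∈ if 4 ∣ m then dilatedSets (m / 4) else ∅ := by
      rwa [if_pos ⟨q, hq⟩, show m / 4 = q by omega]
    rcases eq_of_card_posDiffs_eq_four hm hS h0 hmS hQ with
      ⟨a, b, h1, h2, h3, rfl⟩ | ⟨a, b, c, h1, h2, h3, h4, rfl⟩
    · rcases (card_posDiffs_quadruple h1 h2 h3).1 hQ with ⟨e, e'⟩ | ⟨e, e'⟩ | ⟨e, e'⟩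
      · left
        refine Finset.mem_image.2 ⟨a, ?_, ?_⟩
        · simp only [Finset.mem_filter, Finset.mem_Ico]
          omega
        · rw [show m - a = b by omega]
      · right
        refine of_dvd e' ?_
        subst e e'
        simp [dilatedSets]
      · right
        obtain ⟨q, rfl⟩ : ∃ q, a = 2 * q := ⟨a / 2, by omega⟩
        obtain rfl : b = 3 * q := by omega
        obtain rfl : m = 4 * q := by omega
        exact of_dvd rfl (by simp [dilatedSets])
    · obtain ⟨rfl, rfl, rfl⟩ := (card_posDiffs_quintuple h1 h2 h3 h4).1 hQ
      exact Or.inr (of_dvd rfl (by simp [dilatedSets]))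
  · rintro (h | h)
    · obtain ⟨a, ha, rfl⟩ := Finset.mem_image.1 h
      simp only [Finset.mem_filter, Finset.mem_Ico] at ha
      refine ⟨?_, by simp, by simp, (card_posDiffs_quadruple (by omega) (by omega) (by omega)).2
        (Or.inl (by omega))⟩
      simp only [Finset.mem_insert, Finset.mem_singleton]
      omega
    · split_ifs at h with hd
      · obtain ⟨q, rfl⟩ := hd
        rw [Nat.mul_div_cancel_left q (by norm_num)] at h
        simp only [dilatedSets, Finset.mem_insert, Finset.mem_singleton] at h
        rcases h with rfl | rfl | rfl
        · refine ⟨?_, by simp, by simp, (card_posDiffs_quintuple (by omega) (by omega) (by omega)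
            (by omega)).2 (by omega)⟩
          simp only [Finset.mem_insert, Finset.mem_singleton]
          omega
        · refine ⟨?_, by simp, by simp, (card_posDiffs_quadruple (by omega) (by omega)
            (by omega)).2 (by omega)⟩
          simp only [Finset.mem_insert, Finset.mem_singleton]
          omega
        · refine ⟨?_, by simp, by simp, (card_posDiffs_quadruple (by omega) (by omega)
            (by omega)).2 (by omega)⟩
          simp only [Finset.mem_insert, Finset.mem_singleton]
          omega
      · simp at h

lemma card_symmetricSets {m : ℕ} (hm : 0 < m) :
    (symmetricSets m).card + (if 3 ∣ m then 1 else 0) = (m + 1) / 2 - 1 := by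
  have hinj : Set.InjOn (fun a => ({0, a, m - a, m} : Finset ℕ))
      ((Finset.Ico 1 ((m + 1) / 2)).filter (fun a => 3 * a ≠ m)) := by
    intro a ha b hb hab
    simp only [Finset.coe_filter, Finset.mem_Ico, Set.mem_ofPred_eq] at ha hb
    have h := (Finset.ext_iff.1 hab a).1 (by simp)
    simp only [Finset.mem_insert, Finset.mem_singleton] at h
    omega
  rw [symmetricSets, Finset.card_image_of_injOn hinj]
  have hsum := Finset.card_filter_add_card_filter_not (s := Finset.Ico 1 ((m + 1) / 2))
    (fun a => 3 * a ≠ m)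
  rw [Nat.card_Ico] at hsum
  rw [← hsum]
  congr 1
  split_ifs with hd
  · obtain ⟨q, rfl⟩ := hd
    symm
    rw [Finset.card_eq_one]
    refine ⟨q, ?_⟩
    ext a
    simp only [Finset.mem_filter, Finset.mem_Ico, Finset.mem_singleton]
    omega
  · symm
    rw [Finset.card_eq_zero, Finset.filter_eq_empty_iff]
    intro a _ h
    exact hd ⟨a, by omega⟩

lemma card_dilatedSets {q : ℕ} (hq : 0 < q) : (dilatedSets q).card = 3 := by
  have ne {S T : Finset ℕ} (x : ℕ) (h : x ∈ S) (h' : x ∉ T) : S ≠ T := fun e => h' (e ▸ h)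
  rw [Finset.card_eq_three]
  exact ⟨_, _, _, ne (3 * q) (by simp) (by simp; omega), ne q (by simp) (by simp; omega),
    ne q (by simp) (by simp; omega), rfl⟩

lemma disjoint_symmetricSets_dilatedSets {q : ℕ} (hq : 0 < q) :
    Disjoint (symmetricSets (4 * q)) (dilatedSets q) := by
  rw [Finset.disjoint_left]
  intro S hS hS'
  obtain ⟨a, ha, rfl⟩ := Finset.mem_image.1 hS
  simp only [Finset.mem_filter, Finset.mem_Ico] at ha
  have h : 2 * q ∈ ({0, a, 4 * q - a, 4 * q} : Finset ℕ) := by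
    simp only [dilatedSets, Finset.mem_insert, Finset.mem_singleton] at hS'
    rcases hS' with h | h | h <;> rw [h] <;> simp
  simp only [Finset.mem_insert, Finset.mem_singleton] at h
  omega

/-- For every integer `n ≥ 11`,
`P(f⁻_{[0,n-1]}(R_n'') = n-5) = (⌈(n-1)/2⌉ - 1)/2^{n-2} - [3 ∣ n-1]/2^{n-2} + 3·[4 ∣ n-1]/2^{n-2}`. -/
theorem missing_diffs_n_sub_five (n : ℕ) (hn : 11 ≤ n) :
    pR'' n (fun S => missDiff S 0 ((n : ℤ) - 1) = n - 5) =
      ((⌈((n : ℝ) - 1) / 2⌉ : ℝ) - 1) / 2 ^ (n - 2) -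
        (if 3 ∣ n - 1 then (1 : ℝ) else 0) / 2 ^ (n - 2) +
        3 * (if 4 ∣ n - 1 then (1 : ℝ) else 0) / 2 ^ (n - 2) := by
  obtain ⟨m, rfl⟩ : ∃ m, n = m + 1 := ⟨n - 1, by omega⟩
  have hm : 0 < m := by omega
  have hcard : ((Finset.range (m + 1)).powerset.filter (fun S => 0 ∈ S ∧ m + 1 - 1 ∈ S ∧
      missDiff S 0 (((m + 1 : ℕ) : ℤ) - 1) = m + 1 - 5)) =
      symmetricSets m ∪ if 4 ∣ m then dilatedSets (m / 4) else ∅ := by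
    ext S
    rw [← card_posDiffs_eq_four_iff hm, Finset.mem_filter, Finset.mem_powerset,
      Nat.add_sub_cancel, show (((m + 1 : ℕ) : ℤ) - 1) = m by push_cast; ring]
    refine and_congr ?_ (and_congr_right fun h0 => and_congr_right fun _ => ?_)
    · simp [Finset.subset_iff]
    · have := missDiff_add_card_posDiffs m h0
      omega
  have hsplit : (symmetricSets m ∪ if 4 ∣ m then dilatedSets (m / 4) else ∅).card =
      (symmetricSets m).card + 3 * (if 4 ∣ m then 1 else 0) := by
    split_ifs with hd
    · obtain ⟨q, rfl⟩ := hd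
      rw [Nat.mul_div_cancel_left q (by norm_num),
        Finset.card_union_of_disjoint (disjoint_symmetricSets_dilatedSets (by omega)),
        card_dilatedSets (by omega)]
    · simp
  have hceil : ⌈(((m + 1 : ℕ) : ℝ) - 1) / 2⌉ = (((m + 1) / 2 : ℕ) : ℤ) := by
    rw [Int.ceil_eq_iff]
    have h1 : 2 * ((m + 1) / 2) ≤ m + 1 := by omega
    have h2 : m ≤ 2 * ((m + 1) / 2) := by omega
    have h1' : (2 : ℝ) * (((m + 1) / 2 : ℕ) : ℝ) ≤ m + 1 := by exact_mod_cast h1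
    have h2' : (m : ℝ) ≤ 2 * (((m + 1) / 2 : ℕ) : ℝ) := by exact_mod_cast h2
    rw [Int.cast_natCast]
    push_cast at h1' h2' ⊢
    constructor <;> linarith
  have hsym : ((symmetricSets m).card : ℝ) =
      (((m + 1) / 2 : ℕ) : ℝ) - 1 - (if 3 ∣ m then 1 else 0) := by
    have h : (symmetricSets m).card + (if 3 ∣ m then 1 else 0) + 1 = (m + 1) / 2 := by
      have := card_symmetricSets hm
      omega
    rw [← h]
    push_cast
    ring
  unfold pR''
  have hc := congrArg Finset.card hcard
  rw [hsplit] at hc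
  rw [hceil, Int.cast_natCast, Nat.add_sub_cancel]
  trans (((symmetricSets m).card + 3 * (if 4 ∣ m then 1 else 0) : ℕ) : ℝ) / 2 ^ (m + 1 - 2)
  · rw [← hc]
    congr!
  · push_cast
    rw [hsym]
    ring
end

section
/- For every nonnegative integer m, lim_{n→∞} P(f⁻_{[0,n−1]}(R_n'') = m) = lim_{n→∞} P(f⁻_{[n,2n−1]}(R_{2n}'') = m); moreover lim_{n→∞} P(f⁻_{[0,n−1]}(R_{2n}'') ≥ 1) = 0, i.e. with probability tending to 1 the random set R_{2n}'' misses no difference in [0, n−1]. -/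
open Finset Filter

/-- `k` is not a difference of two elements of `S`. -/
def IsMissingDiff (S : Finset ℕ) (k : ℤ) : Prop :=
  ¬ ∃ x ∈ S, ∃ y ∈ S, (x : ℤ) - (y : ℤ) = k

lemma one_le_missDiff_iff (S : Finset ℕ) (a b : ℤ) :
    1 ≤ missDiff S a b ↔ ∃ k, a ≤ k ∧ k ≤ b ∧ IsMissingDiff S k := by
  classical
  unfold missDiff IsMissingDiff
  rw [Nat.one_le_iff_ne_zero, ← Nat.pos_iff_ne_zero, Finset.card_pos]
  simp only [Finset.Nonempty, Finset.mem_filter, Finset.mem_Icc, and_assoc]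

lemma missDiff_add (S : Finset ℕ) {a b c : ℤ} (hab : a ≤ b) (hbc : b ≤ c + 1) :
    missDiff S a c = missDiff S a (b - 1) + missDiff S b c := by
  classical
  unfold missDiff
  rw [← Finset.card_union_of_disjoint, ← Finset.filter_union]
  · congr 2
    ext k
    simp only [Finset.mem_union, Finset.mem_Icc]
    omega
  · refine Finset.disjoint_filter_filter ?_
    rw [Finset.disjoint_left]
    intro k
    simp only [Finset.mem_Icc]
    omega

/-- Shifting the window by one while each difference in it moves by one preserves the number of
missing differences. -/
lemma missDiff_eq_of_shift {S T : Finset ℕ} {a b : ℤ}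
    (h : ∀ k, a ≤ k → k ≤ b → (IsMissingDiff S (k + 1) ↔ IsMissingDiff T k)) :
    missDiff S (a + 1) (b + 1) = missDiff T a b := by
  classical
  unfold missDiff
  symm
  refine Finset.card_bij (fun k _ => k + 1) ?_ ?_ ?_
  · intro k hk
    simp only [Finset.mem_filter, Finset.mem_Icc] at hk ⊢
    exact ⟨by omega, (h k hk.1.1 hk.1.2).2 hk.2⟩
  · intro k _ l _ hkl
    exact add_right_cancel hkl
  · intro k hk
    simp only [Finset.mem_filter, Finset.mem_Icc] at hk
    refine ⟨k - 1, ?_, by ring⟩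
    simp only [Finset.mem_filter, Finset.mem_Icc]
    refine ⟨by omega, (h (k - 1) (by omega) (by omega)).1 ?_⟩
    rw [sub_add_cancel]
    exact hk.2

lemma pR''_mono_add {n : ℕ} {p q r : Finset ℕ → Prop}
    (h : ∀ S, 0 ∈ S → p S → q S ∨ r S) : pR'' n p ≤ pR'' n q + pR'' n r := by
  classical
  unfold pR''
  rw [← add_div]
  refine div_le_div_of_nonneg_right ?_ (by positivity)
  norm_cast
  refine le_trans (Finset.card_le_card ?_) (Finset.card_union_le _ _)
  intro S hS
  simp only [Finset.mem_union, Finset.mem_filter] at hS ⊢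
  rcases h S hS.2.1 hS.2.2.2 with h | h
  · exact Or.inl ⟨hS.1, hS.2.1, hS.2.2.1, h⟩
  · exact Or.inr ⟨hS.1, hS.2.1, hS.2.2.1, h⟩

lemma pR''_false (n : ℕ) : pR'' n (fun _ => False) = 0 := by
  simp [pR'']

lemma pR''_nonneg (n : ℕ) (p : Finset ℕ → Prop) : 0 ≤ pR'' n p := by
  unfold pR''
  positivity

lemma pR''_mono {n : ℕ} {p q : Finset ℕ → Prop} (h : ∀ S, 0 ∈ S → p S → q S) :
    pR'' n p ≤ pR'' n q := by
  have := pR''_mono_add (n := n) (p := p) (q := q) (r := fun _ => False)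
    fun S hS hp => Or.inl (h S hS hp)
  rwa [pR''_false, add_zero] at this

lemma abs_pR''_sub_le {n : ℕ} {p q r : Finset ℕ → Prop} (h : ∀ S, ¬ r S → (p S ↔ q S)) :
    |pR'' n p - pR'' n q| ≤ pR'' n r := by
  have h₁ : pR'' n p ≤ pR'' n q + pR'' n r := pR''_mono_add fun S _ hp => by
    by_cases hr : r S
    · exact Or.inr hr
    · exact Or.inl ((h S hr).1 hp)
  have h₂ : pR'' n q ≤ pR'' n p + pR'' n r := pR''_mono_add fun S _ hq => by
    by_cases hr : r S
    · exact Or.inr hr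
    · exact Or.inl ((h S hr).2 hq)
  rw [abs_le]
  constructor <;> linarith

open Classical in
lemma pR''_le_four_mul {n : ℕ} (hn : 2 ≤ n) (p : Finset ℕ → Prop) :
    pR'' n p ≤ 4 * ((((Finset.range n).powerset.filter p).card : ℝ) / 2 ^ n) := by
  unfold pR''
  obtain ⟨m, rfl⟩ := Nat.exists_eq_add_of_le' hn
  rw [Nat.add_sub_cancel, pow_add, mul_div_assoc', div_le_div_iff₀ (by positivity) (by positivity)]
  have : (((Finset.range (m + 2)).powerset.filter
      (fun S => 0 ∈ S ∧ m + 2 - 1 ∈ S ∧ p S)).card : ℝ) ≤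
      (((Finset.range (m + 2)).powerset.filter p).card : ℝ) := by
    norm_cast
    refine Finset.card_le_card (Finset.monotone_filter_right _ ?_)
    exact fun S _ hS => hS.2.2
  nlinarith [pow_pos (two_pos (α := ℝ)) m]

open Classical in
/-- Splitting the subsets of `insert a s` according to whether they contain `a`. -/
lemma card_filter_powerset_insert {s : Finset ℕ} {a : ℕ} (ha : a ∉ s) (p : Finset ℕ → Prop) :
    ((insert a s).powerset.filter p).card =
      (s.powerset.filter p).card + (s.powerset.filter fun T => p (insert a T)).card := by
  simp only [Finset.card_filter]
  exact Finset.sum_powerset_insert ha _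

/-- `S` contains no pair `{x, x + k}` with `x ∈ A`. -/
def AvoidsPairs (k : ℕ) (A S : Finset ℕ) : Prop :=
  ∀ x ∈ A, ¬ (x ∈ S ∧ x + k ∈ S)

open Classical in
/-- If the pairs `{x, x + k}`, `x ∈ A`, are disjoint subsets of `U`, then the proportion of subsets
of `U` containing none of these pairs is at most `(3 / 4) ^ |A|`. -/
lemma card_avoiding_pairs_le (k : ℕ) (hk : 0 < k) (A : Finset ℕ) (hA : ∀ x ∈ A, x + k ∉ A) :
    ∀ U : Finset ℕ, (∀ x ∈ A, x ∈ U ∧ x + k ∈ U) →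
      (U.powerset.filter fun S => AvoidsPairs k A S).card * 4 ^ A.card ≤
        3 ^ A.card * 2 ^ U.card := by
  induction A using Finset.induction_on with
  | empty => intro U _; simp [AvoidsPairs]
  | insert a A ha ih =>
    intro U hU
    obtain ⟨V, hV⟩ : ∃ V, V = (U.erase a).erase (a + k) := ⟨_, rfl⟩
    have haU := hU a (Finset.mem_insert_self _ _)
    have hbV : a + k ∉ V := by simp [hV]
    have haV : a ∉ insert (a + k) V := by simp [hV]; omega
    have hUV : U = insert a (insert (a + k) V) := by
      rw [hV, Finset.insert_erase, Finset.insert_erase haU.1]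
      simp only [Finset.mem_erase]
      exact ⟨by omega, haU.2⟩
    have hAV : ∀ x ∈ A, x ∈ V ∧ x + k ∈ V := by
      intro x hx
      have hxU := hU x (Finset.mem_insert_of_mem hx)
      have hxa : x ≠ a := fun h => ha (h ▸ hx)
      have hxb : x ≠ a + k := fun h =>
        hA a (Finset.mem_insert_self _ _) (h ▸ Finset.mem_insert_of_mem hx)
      have hxka : x + k ≠ a := fun h =>
        hA x (Finset.mem_insert_of_mem hx) (h ▸ Finset.mem_insert_self _ _)
      simp only [hV, Finset.mem_erase]
      exact ⟨⟨hxb, hxa, hxU.1⟩, by omega, hxka, hxU.2⟩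
    have hV' := ih (fun x hx h => hA x (Finset.mem_insert_of_mem hx) (Finset.mem_insert_of_mem h))
      V hAV
    have hle : ∀ f : Finset ℕ → Finset ℕ, (∀ T, T ⊆ f T) →
        (V.powerset.filter fun T => AvoidsPairs k (insert a A) (f T)).card ≤
        (V.powerset.filter fun S => AvoidsPairs k A S).card := by
      intro f hf
      refine Finset.card_le_card (Finset.monotone_filter_right _ ?_)
      exact fun T _ hT x hx h =>
        hT x (Finset.mem_insert_of_mem hx) ⟨hf T h.1, hf T h.2⟩
    have h₁ := hle id (fun T => subset_rfl)
    have h₂ := hle (insert (a + k)) (fun T => Finset.subset_insert _ _)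
    have h₃ := hle (insert a) (fun T => Finset.subset_insert _ _)
    have h₄ : (V.powerset.filter fun T =>
        AvoidsPairs k (insert a A) (insert a (insert (a + k) T))).card = 0 := by
      rw [Finset.card_eq_zero, Finset.filter_eq_empty_iff]
      exact fun T _ h => h a (Finset.mem_insert_self _ _) (by simp)
    rw [hUV, card_filter_powerset_insert haV, card_filter_powerset_insert hbV,
      card_filter_powerset_insert hbV, h₄, Finset.card_insert_of_notMem ha,
      Finset.card_insert_of_notMem haV, Finset.card_insert_of_notMem hbV, pow_succ, pow_succ,
      pow_succ, pow_succ]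
    simp only [id] at h₁
    generalize (V.powerset.filter fun S => AvoidsPairs k A S).card = c at *
    calc _ ≤ (c + c + (c + 0)) * (4 ^ A.card * 4) := by gcongr
      _ = 12 * (c * 4 ^ A.card) := by ring
      _ ≤ 12 * (3 ^ A.card * 2 ^ V.card) := by gcongr
      _ = _ := by ring

/-- At least half of the `x < n` lie in an even-indexed block of length `k`. -/
lemma le_two_mul_card_filter_even_div (n k : ℕ) (hk : 0 < k) :
    n ≤ 2 * ((Finset.range n).filter fun x => Even (x / k)).card := by
  have hsum := Finset.card_filter_add_card_filter_not (s := Finset.range n) fun x => Even (x / k)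
  have hle : ((Finset.range n).filter fun x => ¬ Even (x / k)).card ≤
      ((Finset.range n).filter fun x => Even (x / k)).card := by
    have hkx : ∀ x, ¬ Even (x / k) → k ≤ x := fun x hx => by
      by_contra h
      rw [Nat.div_eq_of_lt (not_le.1 h)] at hx
      exact hx Even.zero
    refine Finset.card_le_card_of_injOn (fun x => x - k) ?_ ?_
    · intro x hx
      simp only [Finset.coe_filter, Finset.mem_range, Set.mem_ofPred_eq] at hx ⊢
      have hxk := hkx x hx.2
      obtain ⟨y, rfl⟩ := Nat.exists_eq_add_of_le' hxk
      rw [Nat.add_div_right _ hk, Nat.even_add_one, not_not] at hx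
      rw [Nat.add_sub_cancel]
      exact ⟨by omega, hx.2⟩
    · intro x hx y hy hxy
      simp only [Finset.coe_filter, Finset.mem_range, Set.mem_ofPred_eq] at hx hy hxy
      have := hkx x hx.2
      have := hkx y hy.2
      omega
  rw [Finset.card_range] at hsum
  omega

lemma pR''_isMissingDiff_le {n k : ℕ} (hn : 2 ≤ n) (hk : 0 < k) :
    pR'' n (fun S => IsMissingDiff S k) ≤ 4 * (7 / 8) ^ (n - k) := by
  classical
  refine (pR''_le_four_mul hn _).trans (mul_le_mul_of_nonneg_left ?_ (by norm_num))
  set A := (Finset.range (n - k)).filter fun x => Even (x / k) with hAdef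
  have hA : ∀ x ∈ A, x + k ∉ A := by
    intro x hx hxk
    simp only [hAdef, Finset.mem_filter] at hx hxk
    rw [Nat.add_div_right _ hk, Nat.even_add_one] at hxk
    exact hxk.2 hx.2
  have hAU : ∀ x ∈ A, x ∈ Finset.range n ∧ x + k ∈ Finset.range n := by
    intro x hx
    simp only [hAdef, Finset.mem_filter, Finset.mem_range] at hx ⊢
    omega
  have hcount := card_avoiding_pairs_le k hk A hA (Finset.range n) hAU
  have hcard : n - k ≤ 2 * A.card := le_two_mul_card_filter_even_div (n - k) k hk
  have hsub : ((Finset.range n).powerset.filter fun S => IsMissingDiff S k).card ≤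
      ((Finset.range n).powerset.filter fun S => AvoidsPairs k A S).card := by
    refine Finset.card_le_card (Finset.monotone_filter_right _ ?_)
    exact fun S _ hS x _ h => hS ⟨x + k, h.2, x, h.1, by push_cast; ring⟩
  rw [Finset.card_range] at hcount
  have hreal : (((Finset.range n).powerset.filter fun S => IsMissingDiff S k).card : ℝ) *
      4 ^ A.card ≤ 3 ^ A.card * 2 ^ n := by
    exact_mod_cast (Nat.mul_le_mul_right _ hsub).trans hcount
  calc (((Finset.range n).powerset.filter fun S => IsMissingDiff S k).card : ℝ) / 2 ^ n
      ≤ 3 ^ A.card / 4 ^ A.card := by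
        rwa [div_le_div_iff₀ (by positivity) (by positivity)]
    _ = (3 / 4) ^ A.card := by rw [div_pow]
    _ ≤ ((7 / 8) ^ 2) ^ A.card := by gcongr; norm_num
    _ = (7 / 8) ^ (2 * A.card) := by rw [pow_mul]
    _ ≤ (7 / 8) ^ (n - k) := pow_le_pow_of_le_one (by norm_num) (by norm_num) hcard

lemma pR''_exists_isMissingDiff_le {n : ℕ} (hn : 2 ≤ n) (M : ℕ) (hM : M ≤ n) :
    pR'' n (fun S => ∃ k : ℕ, 0 < k ∧ k ≤ M ∧ IsMissingDiff S k) ≤ 32 * (7 / 8) ^ (n - M) := by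
  induction M with
  | zero =>
    refine (pR''_mono (q := fun _ => False) ?_).trans ?_
    · rintro S - ⟨k, hk, hk', -⟩
      omega
    · rw [pR''_false]
      positivity
  | succ M ih =>
    have hsplit : pR'' n (fun S => ∃ k : ℕ, 0 < k ∧ k ≤ M + 1 ∧ IsMissingDiff S k) ≤
        pR'' n (fun S => ∃ k : ℕ, 0 < k ∧ k ≤ M ∧ IsMissingDiff S k) +
          pR'' n (fun S => IsMissingDiff S ((M + 1 : ℕ) : ℤ)) := by
      refine pR''_mono_add ?_
      rintro S - ⟨k, hk, hkM, hS⟩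
      rcases Nat.le_succ_iff.1 hkM with h | rfl
      · exact Or.inl ⟨k, hk, h, hS⟩
      · exact Or.inr hS
    have hM' := pR''_isMissingDiff_le hn (Nat.succ_pos M)
    have hpow : (7 / 8 : ℝ) ^ (n - M) = 7 / 8 * (7 / 8) ^ (n - (M + 1)) := by
      rw [← pow_succ']
      congr 1
      omega
    have := ih (by omega)
    rw [hpow] at this
    simp only [Nat.succ_eq_add_one] at hM'
    linarith

/-- With probability at least `1 - 32 * (7 / 8) ^ J`, no difference in `[0, n - J - 1]` is
missing. -/
lemma pR''_one_le_missDiff_le {n J : ℕ} (hn : 2 ≤ n) (hJ : J ≤ n) :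
    pR'' n (fun S => 1 ≤ missDiff S 0 ((n : ℤ) - J - 1)) ≤ 32 * (7 / 8) ^ J := by
  have h := pR''_exists_isMissingDiff_le hn (n - J) (Nat.sub_le _ _)
  rw [Nat.sub_sub_self hJ] at h
  refine le_trans (pR''_mono ?_) h
  intro S h0 hS
  obtain ⟨k, hk0, hk, hkS⟩ := (one_le_missDiff_iff _ _ _).1 hS
  lift k to ℕ using hk0
  refine ⟨k, ?_, by omega, hkS⟩
  rcases Nat.eq_zero_or_pos k with rfl | hk'
  · exact absurd ⟨0, h0, 0, h0, by simp⟩ hkS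
  · exact hk'

/-- The order embedding of `ℕ` into itself whose range omits exactly `J`. -/
def skip (J : ℕ) : ℕ ↪ ℕ where
  toFun x := if x < J then x else x + 1
  inj' x y h := by
    dsimp only at h
    split_ifs at h <;> omega

lemma skip_apply (J x : ℕ) : skip J x = if x < J then x else x + 1 := rfl

lemma range_succ_eq_insert_map_skip {n J : ℕ} (hJ : J ≤ n) :
    Finset.range (n + 1) = insert J ((Finset.range n).map (skip J)) := by
  ext x
  simp only [Finset.mem_range, Finset.mem_insert, Finset.mem_map, skip_apply]
  constructor
  · intro hx
    rcases lt_trichotomy x J with h | h | h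
    · exact Or.inr ⟨x, by omega, by simp [h]⟩
    · exact Or.inl h
    · exact Or.inr ⟨x - 1, by omega, by rw [if_neg (by omega)]; omega⟩
  · rintro (rfl | ⟨y, hy, rfl⟩)
    · omega
    · split_ifs <;> omega

lemma notMem_map_skip (J : ℕ) (S : Finset ℕ) : J ∉ S.map (skip J) := by
  simp only [Finset.mem_map, skip_apply, not_exists, not_and]
  intro x _
  split_ifs <;> omega

lemma mem_map_skip_of_lt {J x : ℕ} (S : Finset ℕ) (hx : x < J) : x ∈ S.map (skip J) ↔ x ∈ S := by
  have : skip J x = x := by simp [skip_apply, hx]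
  conv_lhs => rw [← this]
  exact Finset.mem_map' _

lemma succ_mem_map_skip_of_le {J x : ℕ} (S : Finset ℕ) (hx : J ≤ x) :
    x + 1 ∈ S.map (skip J) ↔ x ∈ S := by
  have : skip J x = x + 1 := by simp [skip_apply, hx]
  conv_lhs => rw [← this]
  exact Finset.mem_map' _

open Classical in
lemma card_filter_powerset_map (e : ℕ ↪ ℕ) (s : Finset ℕ) (p : Finset ℕ → Prop) :
    ((s.map e).powerset.filter p).card = (s.powerset.filter fun T => p (T.map e)).card := by
  symm
  refine Finset.card_bij (fun T _ => T.map e) ?_ ?_ ?_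
  · intro T hT
    simp only [Finset.mem_filter, Finset.mem_powerset] at hT ⊢
    exact ⟨Finset.map_subset_map.2 hT.1, hT.2⟩
  · intro T _ T' _ h
    exact Finset.map_injective e h
  · intro T hT
    simp only [Finset.mem_filter, Finset.mem_powerset] at hT
    obtain ⟨T', hT', rfl⟩ := Finset.subset_map_iff.1 hT.1
    exact ⟨T', by simpa only [Finset.mem_filter, Finset.mem_powerset] using ⟨hT', hT.2⟩, rfl⟩

/-- The top `J` differences are unaffected when a point is added in the middle. -/
lemma missDiff_top_eq {n J : ℕ} (hn : 2 * J ≤ n) {S T : Finset ℕ} (hT : T ⊆ Finset.range n)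
    (hS : S ⊆ Finset.range (n + 1)) (hlow : ∀ x < J, (x ∈ S ↔ x ∈ T))
    (hhigh : ∀ x, J ≤ x → (x + 1 ∈ S ↔ x ∈ T)) :
    missDiff S (((n + 1 : ℕ) : ℤ) - J) (((n + 1 : ℕ) : ℤ) - 1) =
      missDiff T ((n : ℤ) - J) ((n : ℤ) - 1) := by
  have e₁ : ((n + 1 : ℕ) : ℤ) - J = (n : ℤ) - J + 1 := by push_cast; ring
  have e₂ : ((n + 1 : ℕ) : ℤ) - 1 = (n : ℤ) - 1 + 1 := by push_cast; ring
  rw [e₁, e₂]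
  refine missDiff_eq_of_shift fun k hk hk' => not_congr ?_
  constructor
  · rintro ⟨x, hx, y, hy, hxy⟩
    have := Finset.mem_range.1 (hS hx)
    obtain ⟨z, rfl⟩ : ∃ z, x = z + 1 := ⟨x - 1, by omega⟩
    exact ⟨z, (hhigh z (by omega)).1 hx, y, (hlow y (by omega)).1 hy, by push_cast at hxy; omega⟩
  · rintro ⟨x, hx, y, hy, hxy⟩
    have := Finset.mem_range.1 (hT hx)
    exact ⟨x + 1, (hhigh x (by omega)).2 hx, y, (hlow y (by omega)).2 hy, by push_cast; omega⟩

lemma pR''_missDiff_top_succ (m : ℕ) {n J : ℕ} (hJ : 0 < J) (hn : 2 * J ≤ n) :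
    pR'' (n + 1) (fun S => missDiff S (((n + 1 : ℕ) : ℤ) - J) (((n + 1 : ℕ) : ℤ) - 1) = m) =
      pR'' n (fun S => missDiff S ((n : ℤ) - J) ((n : ℤ) - 1) = m) := by
  classical
  obtain ⟨P, hP⟩ : ∃ P : ℕ → Finset ℕ → Prop, ∀ l S, P l S ↔
      0 ∈ S ∧ l - 1 ∈ S ∧ missDiff S ((l : ℤ) - J) ((l : ℤ) - 1) = m := ⟨_, fun _ _ => Iff.rfl⟩
  have hpR : ∀ l : ℕ, pR'' l (fun S => missDiff S ((l : ℤ) - J) ((l : ℤ) - 1) = m) =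
      (((Finset.range l).powerset.filter (P l)).card : ℝ) / 2 ^ (l - 2) := by
    intro l
    unfold pR''
    congr 3
    ext S
    simp only [Finset.mem_filter, hP]
  have key : ∀ f : Finset ℕ → Finset ℕ, (∀ T, T ⊆ Finset.range n → f T ⊆ Finset.range (n + 1)) →
      (∀ T, ∀ x < J, (x ∈ f T ↔ x ∈ T)) → (∀ T, ∀ x, J ≤ x → (x + 1 ∈ f T ↔ x ∈ T)) →
      ((Finset.range n).powerset.filter fun T => P (n + 1) (f T)) =
        (Finset.range n).powerset.filter (P n) := by
    intro f hf hlow hhigh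
    refine Finset.filter_congr fun T hT => ?_
    rw [Finset.mem_powerset] at hT
    rw [hP, hP, hlow T 0 hJ, missDiff_top_eq hn hT (hf T hT) (hlow T) (hhigh T),
      ← hhigh T (n - 1) (by omega), show n - 1 + 1 = n + 1 - 1 by omega]
  have hmap : ∀ T, T ⊆ Finset.range n → insert J (T.map (skip J)) ⊆ Finset.range (n + 1) := by
    intro T hT
    rw [range_succ_eq_insert_map_skip (show J ≤ n by omega)]
    exact Finset.insert_subset_insert _ (Finset.map_subset_map.2 hT)
  have k₁ := key (fun T => T.map (skip J))
    (fun T hT => (Finset.subset_insert _ _).trans (hmap T hT))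
    (fun T x hx => mem_map_skip_of_lt T hx) (fun T x hx => succ_mem_map_skip_of_le T hx)
  have k₂ := key (fun T => insert J (T.map (skip J))) hmap
    (fun T x hx => by rw [Finset.mem_insert, mem_map_skip_of_lt T hx]; simp [hx.ne])
    (fun T x hx => by
      rw [Finset.mem_insert, succ_mem_map_skip_of_le T hx]
      simp [show x + 1 ≠ J by omega])
  rw [hpR, hpR, show n + 1 - 2 = n - 2 + 1 by omega, pow_succ,
    div_eq_div_iff (by positivity) (by positivity),
    range_succ_eq_insert_map_skip (show J ≤ n by omega),
    card_filter_powerset_insert (notMem_map_skip _ _), card_filter_powerset_map,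
    card_filter_powerset_map, k₁, k₂]
  push_cast
  ring

lemma pR''_missDiff_top_eq (m : ℕ) {n J : ℕ} (hJ : 0 < J) (hn : 2 * J ≤ n) :
    pR'' n (fun S => missDiff S ((n : ℤ) - J) ((n : ℤ) - 1) = m) =
      pR'' (2 * J) (fun S => missDiff S (((2 * J : ℕ) : ℤ) - J) (((2 * J : ℕ) : ℤ) - 1) = m) := by
  induction n, hn using Nat.le_induction with
  | base => rfl
  | succ n hn ih => rw [pR''_missDiff_top_succ m hJ hn, ih]

/-- Restricting to the top `J` differences changes the law of the number of missing differences by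
at most `32 * (7 / 8) ^ J`. -/
lemma abs_pR''_missDiff_sub_top_le (m : ℕ) {n J : ℕ} (hn : 2 ≤ n) (hJ : J ≤ n) :
    |pR'' n (fun S => missDiff S 0 ((n : ℤ) - 1) = m) -
      pR'' n (fun S => missDiff S ((n : ℤ) - J) ((n : ℤ) - 1) = m)| ≤ 32 * (7 / 8) ^ J := by
  refine (abs_pR''_sub_le ?_).trans (pR''_one_le_missDiff_le hn hJ)
  intro S hS
  rw [missDiff_add S (b := (n : ℤ) - J) (by omega) (by omega),
    show missDiff S 0 ((n : ℤ) - J - 1) = 0 by omega, zero_add]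

lemma tendsto_const_mul_pow_zero :
    Tendsto (fun J : ℕ => (32 * (7 / 8) ^ J : ℝ)) atTop (nhds 0) := by
  simpa using (tendsto_pow_atTop_nhds_zero_of_lt_one (r := (7 / 8 : ℝ)) (by norm_num)
    (by norm_num)).const_mul 32

lemma cauchySeq_pR''_missDiff (m : ℕ) :
    CauchySeq (fun n : ℕ => pR'' n (fun S => missDiff S 0 ((n : ℤ) - 1) = m)) := by
  rw [Metric.cauchySeq_iff']
  intro ε hε
  obtain ⟨J, hJε, hJ⟩ := ((tendsto_const_mul_pow_zero.eventually_lt_const (half_pos hε)).and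
    (eventually_ge_atTop 1)).exists
  refine ⟨2 * J, fun n hn => ?_⟩
  have h₁ := abs_pR''_missDiff_sub_top_le m (n := n) (J := J) (by omega) (by omega)
  have h₂ := abs_pR''_missDiff_sub_top_le m (n := 2 * J) (J := J) (by omega) (by omega)
  rw [pR''_missDiff_top_eq m hJ hn] at h₁
  rw [Real.dist_eq]
  rw [abs_le] at h₁ h₂
  rw [abs_lt]
  constructor <;> linarith [h₁.1, h₁.2, h₂.1, h₂.2]

/-- For every nonnegative integer `m`,
`lim_{n→∞} P(f⁻_{[0,n-1]}(R_n'') = m) = lim_{n→∞} P(f⁻_{[n,2n-1]}(R_{2n}'') = m)`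
(both limits exist), and moreover `lim_{n→∞} P(f⁻_{[0,n-1]}(R_{2n}'') ≥ 1) = 0`. -/
theorem missing_diffs_limit_top_half (m : ℕ) :
    (∃ L : ℝ,
      Tendsto (fun n : ℕ => pR'' n (fun S => missDiff S 0 ((n : ℤ) - 1) = m))
        atTop (nhds L) ∧
      Tendsto (fun n : ℕ => pR'' (2 * n) (fun S => missDiff S (n : ℤ) (2 * (n : ℤ) - 1) = m))
        atTop (nhds L)) ∧
    Tendsto (fun n : ℕ => pR'' (2 * n) (fun S => 1 ≤ missDiff S 0 ((n : ℤ) - 1)))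
      atTop (nhds 0) := by
  have htwo : Tendsto (fun n : ℕ => 2 * n) atTop atTop :=
    tendsto_id.const_mul_atTop' two_pos
  have hlow : ∀ᶠ n : ℕ in atTop,
      pR'' (2 * n) (fun S => 1 ≤ missDiff S 0 ((n : ℤ) - 1)) ≤ 32 * (7 / 8) ^ n := by
    filter_upwards [eventually_ge_atTop 1] with n hn
    have h := pR''_one_le_missDiff_le (n := 2 * n) (J := n) (by omega) (by omega)
    rwa [show ((2 * n : ℕ) : ℤ) - n - 1 = n - 1 by push_cast; ring] at h
  obtain ⟨L, hL⟩ := cauchySeq_tendsto_of_complete (cauchySeq_pR''_missDiff m)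
  refine ⟨⟨L, hL, ?_⟩, squeeze_zero' (Eventually.of_forall fun n => pR''_nonneg _ _) hlow
    tendsto_const_mul_pow_zero⟩
  refine (hL.comp htwo).congr_dist
    (squeeze_zero' (Eventually.of_forall fun n => dist_nonneg) ?_ tendsto_const_mul_pow_zero)
  filter_upwards [eventually_ge_atTop 1] with n hn
  have h := abs_pR''_missDiff_sub_top_le m (n := 2 * n) (J := n) (by omega) (by omega)
  rw [show ((2 * n : ℕ) : ℤ) - n = n by push_cast; ring] at h
  rw [Real.dist_eq]
  simpa using h
end
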